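/- Suppose c satisfies (A0), (A1), (A2), Λ is c-convex with respect to Ω, and Ω is c*-convex with respect to Λ. If for every c-convex function φ on Ω indexed by Λ and every x ∈ Ω the c-subdifferential equals the ordinary subdifferential, ∂^cφ(x) = ∂φ(x), then c satisfies (A3W). -/

import Mathlib

open scoped RealInnerProductSpace
open Filter Topology Set

noncomputable section

variable {n : ℕ}

local notation "E" => EuclideanSpace ℝ (Fin n)

/-- `-∇ₓ c(x,y)`, the negative gradient of `x' ↦ c(x',y)` at `x`. -/
def negGradX (c : E → E → ℝ) (x y : E) : E :=
  -(gradient (fun x' => c x' y) x)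

/-- `-∇_y c(x,y)`, the negative gradient of `y' ↦ c(x,y')` at `y`. -/
def negGradY (c : E → E → ℝ) (x y : E) : E :=
  -(gradient (fun y' => c x y') y)

/-- The swapped cost `c*(y,x) = c(x,y)`. -/
def cStar (c : E → E → ℝ) : E → E → ℝ := fun y x => c x y

/-- The domain of the `c`-exponential map at `x`: `{-∇ₓ c(x,y) : y ∈ Λ}`. -/
def cExpDom (c : E → E → ℝ) (Λ : Set E) (x : E) : Set E :=
  (fun y => negGradX c x y) '' Λ

/-- The `c`-exponential map: `cExp c Λ x p` is the point `y ∈ Λ` with `p = -∇ₓ c(x,y)`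
(when it exists and is unique). -/
def cExp (c : E → E → ℝ) (Λ : Set E) (x p : E) : E :=
  Function.invFunOn (fun y => negGradX c x y) Λ p

/-- Condition (A0): the cost extends to a `C⁴` function on `cl Ω × cl Λ`. -/
def A0 (c : E → E → ℝ) (Ω Λ : Set E) : Prop :=
  ContDiffOn ℝ 4 (fun q : E × E => c q.1 q.2) (closure Ω ×ˢ closure Λ)

/-- Condition (A1): injectivity of `y ↦ -∇ₓ c(x,y)` on `cl Λ` and of
`x ↦ -∇_y c(x,y)` on `cl Ω`. -/
def A1 (c : E → E → ℝ) (Ω Λ : Set E) : Prop :=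
  (∀ x ∈ Ω, Set.InjOn (fun y => negGradX c x y) (closure Λ)) ∧
  (∀ y ∈ Λ, Set.InjOn (fun x => negGradY c x y) (closure Ω))

/-- Condition (A2): the mixed second derivative `D²ₓᵧ c(x,y)`, as a linear map, is
invertible for all `(x,y) ∈ cl Ω × cl Λ`. -/
def A2 (c : E → E → ℝ) (Ω Λ : Set E) : Prop :=
  ∀ x ∈ closure Ω, ∀ y ∈ closure Λ,
    Function.Bijective (fderiv ℝ (fun y' => negGradX c x y') y)

/-- The `c`-sectional curvature
`𝔖_c(x,y)(η,ξ) = (d²/dt²)|₀ [-D²ₓₓ c](x, cExpₓ(p + tξ))(η,η)` with `p = -∇ₓ c(x,y)`. -/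
def cSectional (c : E → E → ℝ) (Λ : Set E) (x y η ξ : E) : ℝ :=
  deriv (deriv (fun t : ℝ =>
    -(iteratedFDeriv ℝ 2
        (fun x' => c x' (cExp c Λ x (negGradX c x y + t • ξ))) x ![η, η]))) 0

/-- Condition (A3W): nonnegative `c`-sectional curvature in orthogonal directions. -/
def A3W (c : E → E → ℝ) (Ω Λ : Set E) : Prop :=
  ∀ x ∈ Ω, ∀ y ∈ Λ, ∀ η ξ : E, ⟪η, ξ⟫ = 0 → 0 ≤ cSectional c Λ x y η ξ

/-- Condition (A3S): uniformly positive `c`-sectional curvature in orthogonal directions. -/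
def A3S (c : E → E → ℝ) (Ω Λ : Set E) : Prop :=
  ∃ C₀ > (0:ℝ), ∀ x ∈ Ω, ∀ y ∈ Λ, ∀ η ξ : E, ⟪η, ξ⟫ = 0 →
    C₀ * ‖η‖ ^ 2 * ‖ξ‖ ^ 2 ≤ cSectional c Λ x y η ξ

/-- `Λ` is `c`-convex with respect to `Ω`: `(cExpₓ)⁻¹(Λ)` is convex for every `x ∈ Ω`. -/
def CConvexTarget (c : E → E → ℝ) (Ω Λ : Set E) : Prop :=
  ∀ x ∈ Ω, Convex ℝ (cExpDom c Λ x)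

/-- `Ω` is `c*`-convex with respect to `Λ`: `(c*Exp_y)⁻¹(Ω)` is convex for every `y ∈ Λ`. -/
def CStarConvexSource (c : E → E → ℝ) (Ω Λ : Set E) : Prop :=
  ∀ y ∈ Λ, Convex ℝ ((fun x => negGradY c x y) '' Ω)

/-- The `c`-Legendre transform `L^c v(x) = sup_{y ∈ Λ} (-c(x,y) - v(y))`. -/
def cTransform (c : E → E → ℝ) (Λ : Set E) (v : E → EReal) (x : E) : EReal :=
  ⨆ y ∈ Λ, (((-(c x y) : ℝ) : EReal) - v y)

/-- `φ` is a `c`-convex function on `Ω` indexed by `Λ`. -/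
def IsCConvexOn (c : E → E → ℝ) (Ω Λ : Set E) (φ : E → ℝ) : Prop :=
  ∃ v : E → EReal,
    (∀ x ∈ Ω, (φ x : EReal) = cTransform c Λ v x) ∧
    (∀ x ∈ Ω, ∃ y ∈ closure Λ, (φ x : EReal) + v y = ((-(c x y) : ℝ) : EReal))

/-- The `c*`-Legendre transform `L^{c*} φ(y) = sup_{x ∈ Ω} (-c(x,y) - φ(x))`. -/
def cStarTransform (c : E → E → ℝ) (Ω : Set E) (φ : E → ℝ) (y : E) : EReal :=
  ⨆ x ∈ Ω, (((-(c x y) - φ x : ℝ)) : EReal)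

/-- The contact set `G_φ(x) = {y ∈ cl Λ : φ(x) + L^{c*}φ(y) = -c(x,y)}`. -/
def contactSet (c : E → E → ℝ) (Ω Λ : Set E) (φ : E → ℝ) (x : E) : Set E :=
  {y ∈ closure Λ | (φ x : EReal) + cStarTransform c Ω φ y = ((-(c x y) : ℝ) : EReal)}

/-- The (local) subdifferential `∂φ(x)`:
`φ(z) ≥ φ(x) + ⟨p, z - x⟩ + o(‖z - x‖)` as `z → x` in `Ω`. -/
def subdiff (Ω : Set E) (φ : E → ℝ) (x : E) : Set E :=
  {p : E | ∀ ε > (0:ℝ), ∀ᶠ z in 𝓝[Ω] x,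
      φ x + ⟪p, z - x⟫ - ε * ‖z - x‖ ≤ φ z}

/-- The `c`-subdifferential `∂^c φ(x) = {-∇ₓ c(x,y) : y ∈ G_φ(x)}`. -/
def cSubdiff (c : E → E → ℝ) (Ω Λ : Set E) (φ : E → ℝ) (x : E) : Set E :=
  (fun y => negGradX c x y) '' contactSet c Ω Λ φ x

/-- The straight segment `p_θ = (1-θ) p₀ + θ p₁` with `pᵢ = -∇ₓ c(x_m, yᵢ)`. -/
def pSeg (c : E → E → ℝ) (xm y₀ y₁ : E) (θ : ℝ) : E :=
  (1 - θ) • negGradX c xm y₀ + θ • negGradX c xm y₁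

/-- The `c`-segment `y_θ = cExp_{x_m}(p_θ)` joining `y₀` to `y₁` with respect to `x_m`. -/
def ySeg (c : E → E → ℝ) (Λ : Set E) (xm y₀ y₁ : E) (θ : ℝ) : E :=
  cExp c Λ xm (pSeg c xm y₀ y₁ θ)

/-- The sliding mountain `f_θ(x) = -c(x, y_θ) + c(x_m, y_θ)`. -/
def slide (c : E → E → ℝ) (Λ : Set E) (xm y₀ y₁ : E) (θ : ℝ) (x : E) : ℝ :=
  -(c x (ySeg c Λ xm y₀ y₁ θ)) + c xm (ySeg c Λ xm y₀ y₁ θ)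

/-- The `c`-segment `[y₀,y₁]_{x_m}` lies in `Λ`:
each `p_θ`, `θ ∈ [0,1]`, is in the domain of `cExp_{x_m}`. -/
def segInTarget (c : E → E → ℝ) (Λ : Set E) (xm y₀ y₁ : E) : Prop :=
  ∀ θ ∈ Set.Icc (0:ℝ) 1, pSeg c xm y₀ y₁ θ ∈ cExpDom c Λ xm

/-- The level set `S_θ = {x ∈ Ω : (d/dθ) f_θ(x) = 0}`. -/
def Slevel (c : E → E → ℝ) (Ω Λ : Set E) (xm y₀ y₁ : E) (θ : ℝ) : Set E :=
  {x ∈ Ω | deriv (fun θ' => slide c Λ xm y₀ y₁ θ' x) θ = 0}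

/-- The super-level set `S⁺_θ = {x ∈ Ω : (d/dθ) f_θ(x) ≥ 0}`. -/
def Splus (c : E → E → ℝ) (Ω Λ : Set E) (xm y₀ y₁ : E) (θ : ℝ) : Set E :=
  {x ∈ Ω | 0 ≤ deriv (fun θ' => slide c Λ xm y₀ y₁ θ' x) θ}

/-- A strict form of the second-derivative test for maxima. -/
lemma eventually_lt_of_hasDerivAt_neg {f f' : ℝ → ℝ} {a x₀ : ℝ}
    (hf : ∀ᶠ t in 𝓝 x₀, HasDerivAt f (f' t) t) (h0 : f' x₀ = 0)
    (hf' : HasDerivAt f' a x₀) (ha : a < 0) : ∀ᶠ t in 𝓝[≠] x₀, f t < f x₀ := by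
  set g : ℝ → ℝ := fun t => -f t + a / 4 * (t - x₀) ^ 2
  have hg : ∀ᶠ t in 𝓝 x₀, HasDerivAt g (-f' t + a / 2 * (t - x₀)) t := by
    filter_upwards [hf] with t ht
    refine (ht.neg.add ((((hasDerivAt_id t).sub_const x₀).pow 2).const_mul (a / 4))).congr_deriv ?_
    simp
    ring
  have hg' : HasDerivAt (deriv g) (-(a / 2)) x₀ := by
    have h : HasDerivAt (fun t => -f' t + a / 2 * (t - x₀)) (-(a / 2)) x₀ := by
      refine (hf'.neg.add (((hasDerivAt_id x₀).sub_const x₀).const_mul (a / 2))).congr_deriv ?_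
      ring
    exact h.congr_of_eventuallyEq (hg.mono fun t ht => ht.deriv)
  have hmin : IsLocalMin g x₀ := by
    apply isLocalMin_of_deriv_deriv_pos
    · rw [hg'.deriv]; linarith
    · rw [hg.self_of_nhds.deriv, h0]; simp
    · exact hg.self_of_nhds.continuousAt
  filter_upwards [hmin.filter_mono nhdsWithin_le_nhds, self_mem_nhdsWithin] with t ht hne
  have hsq : 0 < (t - x₀) ^ 2 := by
    have : t - x₀ ≠ 0 := sub_ne_zero.mpr hne
    positivity
  simp only [g, sub_self] at ht
  nlinarith

/-- The strict second-derivative test along the parabola `ε ↦ x + ε • η + ε ^ 2 • w`. -/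
lemma eventually_lt_along_parabola {V : Type*} [NormedAddCommGroup V] [NormedSpace ℝ V]
    {f : V → ℝ} {f' : V → V →L[ℝ] ℝ} {f'' : V →L[ℝ] V →L[ℝ] ℝ} {x η w : V}
    (hf : ∀ᶠ z in 𝓝 x, HasFDerivAt f (f' z) z) (hf' : HasFDerivAt f' f'' x)
    (h0 : f' x η = 0) (hneg : f'' η η + 2 * f' x w < 0) :
    ∀ᶠ ε in 𝓝[≠] (0 : ℝ), f (x + ε • η + ε ^ 2 • w) < f x := by
  have hcurve : ∀ ε : ℝ, HasDerivAt (fun ε : ℝ => x + ε • η + ε ^ 2 • w)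
      (η + (2 * ε) • w) ε := by
    intro ε
    refine ((((hasDerivAt_id ε).smul_const η).const_add x).add
      (((hasDerivAt_id ε).pow 2).smul_const w)).congr_deriv ?_
    simp
  have hx : x + (0 : ℝ) • η + (0 : ℝ) ^ 2 • w = x := by simp
  have hlim : Tendsto (fun ε : ℝ => x + ε • η + ε ^ 2 • w) (𝓝 0) (𝓝 x) := by
    have h := (hcurve 0).continuousAt.tendsto
    rwa [hx] at h
  have h := eventually_lt_of_hasDerivAt_neg
    (f := fun ε : ℝ => f (x + ε • η + ε ^ 2 • w))
    (f' := fun ε : ℝ => f' (x + ε • η + ε ^ 2 • w) (η + (2 * ε) • w))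
    (a := f'' η η + 2 * f' x w) (x₀ := 0) ?_ ?_ ?_ hneg
  · simpa using h
  · filter_upwards [hlim.eventually hf] with ε hε
    exact hε.comp_hasDerivAt ε (hcurve ε)
  · simpa using h0
  · have h1 : HasDerivAt (fun ε : ℝ => f' (x + ε • η + ε ^ 2 • w)) (f'' η) 0 := by
      rw [← hx] at hf'
      have h := hf'.comp_hasDerivAt (0 : ℝ) (hcurve 0)
      simp only [mul_zero, zero_smul, add_zero] at h
      exact h
    have h2 : HasDerivAt (fun ε : ℝ => η + (2 * ε) • w) ((2 : ℝ) • w) 0 := by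
      simpa using (((hasDerivAt_id (0 : ℝ)).const_mul 2).smul_const w).const_add η
    simpa using h1.clm_apply h2

section Cost

variable {c : EuclideanSpace ℝ (Fin n) → EuclideanSpace ℝ (Fin n) → ℝ}
  {Ω Λ : Set (EuclideanSpace ℝ (Fin n))} {x y : EuclideanSpace ℝ (Fin n)}

lemma A0.contDiffAt (h0 : A0 c Ω Λ) (hΩ : IsOpen Ω) (hΛ : IsOpen Λ) (hx : x ∈ Ω) (hy : y ∈ Λ) :
    ContDiffAt ℝ 4 (fun q : E × E => c q.1 q.2) (x, y) :=
  ContDiffOn.contDiffAt h0 <| Filter.mem_of_superset ((hΩ.prod hΛ).mem_nhds ⟨hx, hy⟩)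
    (prod_mono subset_closure subset_closure)

lemma contDiffAt_cost_fst (h : ContDiffAt ℝ 4 (fun q : E × E => c q.1 q.2) (x, y)) :
    ContDiffAt ℝ 4 (fun x' => c x' y) x :=
  h.comp x (contDiffAt_id.prodMk contDiffAt_const)

lemma contDiffAt_fderiv_cost_fst (h : ContDiffAt ℝ 4 (fun q : E × E => c q.1 q.2) (x, y)) :
    ContDiffAt ℝ 3 (fun q : E × E => fderiv ℝ (fun x' => c x' q.2) q.1) (x, y) := by
  refine ContDiffAt.fderiv (f := fun (q : E × E) x' => c x' q.2) (g := Prod.fst) (n := 4)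
    ?_ contDiffAt_fst (by norm_num)
  exact ContDiffAt.comp (g := fun q : E × E => c q.1 q.2) ((x, y), x) h
    (contDiffAt_snd.prodMk (contDiffAt_snd.comp _ contDiffAt_fst))

lemma inner_negGradX (x y v : E) :
    ⟪negGradX c x y, v⟫ = -fderiv ℝ (fun x' => c x' y) x v := by
  simp [negGradX, gradient]

lemma contDiffAt_negGradX (h : ContDiffAt ℝ 4 (fun q : E × E => c q.1 q.2) (x, y)) :
    ContDiffAt ℝ 3 (negGradX c x) y := by
  have h1 : ContDiffAt ℝ 3 (fun y' => fderiv ℝ (fun x' => c x' y') x) y :=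
    ContDiffAt.comp y (contDiffAt_fderiv_cost_fst h) (contDiffAt_const.prodMk contDiffAt_id)
  exact ((InnerProductSpace.toDual ℝ E).symm.contDiff.contDiffAt.comp y h1).neg

lemma contDiffAt_fderiv_fderiv_fst (h : ContDiffAt ℝ 4 (fun q : E × E => c q.1 q.2) (x, y)) :
    ContDiffAt ℝ 2 (fun y' => fderiv ℝ (fderiv ℝ (fun x' => c x' y')) x) y := by
  refine ContDiffAt.fderiv (f := fun (y' : E) => fderiv ℝ (fun x' => c x' y'))
    (g := fun _ => x) (n := 3) ?_ contDiffAt_const (by norm_num)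
  exact ContDiffAt.comp (g := fun q : E × E => fderiv ℝ (fun x' => c x' q.2) q.1) (y, x)
    (contDiffAt_fderiv_cost_fst h) (contDiffAt_snd.prodMk contDiffAt_fst)

lemma cExp_negGradX (h1 : A1 c Ω Λ) (hx : x ∈ Ω) (hy : y ∈ Λ) :
    cExp c Λ x (negGradX c x y) = y :=
  ((h1.1 x hx).mono subset_closure).leftInvOn_invFunOn hy

lemma cExp_mem {p : E} (hp : p ∈ cExpDom c Λ x) : cExp c Λ x p ∈ Λ :=
  Function.invFunOn_mem hp

lemma negGradX_cExp {p : E} (hp : p ∈ cExpDom c Λ x) : negGradX c x (cExp c Λ x p) = p :=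
  Function.invFunOn_eq hp

/-- By the inverse function theorem, the domain of the `c`-exponential map is open and the map
is of class `C³`. -/
lemma cExpDom_mem_nhds_and_contDiffAt_cExp (hΩ : IsOpen Ω) (hΛ : IsOpen Λ) (h0 : A0 c Ω Λ)
    (h1 : A1 c Ω Λ) (h2 : A2 c Ω Λ) (hx : x ∈ Ω) (hy : y ∈ Λ) :
    cExpDom c Λ x ∈ 𝓝 (negGradX c x y) ∧ ContDiffAt ℝ 3 (cExp c Λ x) (negGradX c x y) := by
  have hF := contDiffAt_negGradX (h0.contDiffAt hΩ hΛ hx hy)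
  have hbij := h2 x (subset_closure hx) y (subset_closure hy)
  let e : E ≃L[ℝ] E := ContinuousLinearEquiv.ofBijective (fderiv ℝ (negGradX c x) y)
    (LinearMap.ker_eq_bot.mpr hbij.1) (LinearMap.range_eq_top.mpr hbij.2)
  have he : HasFDerivAt (negGradX c x) (e : E →L[ℝ] E) y := by
    exact (hF.differentiableAt (by norm_num)).hasFDerivAt
  have hs := hF.hasStrictFDerivAt' he (by norm_num)
  have hdom : cExpDom c Λ x ∈ 𝓝 (negGradX c x y) := by
    rw [← hs.map_nhds_eq_of_equiv]
    exact image_mem_map (hΛ.mem_nhds hy)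
  refine ⟨hdom, (hF.to_localInverse he (by norm_num)).congr_of_eventuallyEq ?_⟩
  have hinv := hs.localInverse_tendsto.eventually (hΛ.mem_nhds hy)
  filter_upwards [hdom, hs.eventually_right_inverse, hinv] with p hp hr hm
  exact h1.1 x hx (subset_closure (cExp_mem hp)) (subset_closure hm)
    ((negGradX_cExp hp).trans hr.symm)

lemma isCConvexOn_max {y₁ y₂ : E} (hy₁ : y₁ ∈ Λ) (hy₂ : y₂ ∈ Λ) :
    IsCConvexOn c Ω Λ (fun z => max (-c z y₁ + c x y₁) (-c z y₂ + c x y₂)) := by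
  classical
  refine ⟨fun y' => if y' = y₁ ∨ y' = y₂ then ((-c x y' : ℝ) : EReal) else ⊤, fun z _ => ?_,
    fun z _ => ?_⟩
  · apply le_antisymm
    · rcases le_total (-c z y₁ + c x y₁) (-c z y₂ + c x y₂) with h | h
      · refine le_iSup₂_of_le y₂ hy₂ ?_
        simp only [h, max_eq_right, or_true, if_true]
        rw [← EReal.coe_sub, EReal.coe_le_coe_iff]
        linarith
      · refine le_iSup₂_of_le y₁ hy₁ ?_
        simp only [h, max_eq_left, true_or, if_true]
        rw [← EReal.coe_sub, EReal.coe_le_coe_iff]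
        linarith
    · refine iSup₂_le fun y' _ => ?_
      by_cases h : y' = y₁ ∨ y' = y₂
      · simp only [h, if_true]
        rw [← EReal.coe_sub, EReal.coe_le_coe_iff, sub_neg_eq_add]
        rcases h with rfl | rfl
        · exact le_max_left _ _
        · exact le_max_right _ _
      · simp [h]
  · rcases le_total (-c z y₁ + c x y₁) (-c z y₂ + c x y₂) with h | h
    · refine ⟨y₂, subset_closure hy₂, ?_⟩
      simp only [h, max_eq_right, or_true, if_true]
      rw [← EReal.coe_add]
      congr 1
      ring
    · refine ⟨y₁, subset_closure hy₁, ?_⟩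
      simp only [h, max_eq_left, true_or, if_true]
      rw [← EReal.coe_add]
      congr 1
      ring

lemma midpoint_mem_subdiff_max {f₁ f₂ : E → ℝ} {p₁ p₂ : E}
    (h₁ : HasFDerivAt f₁ (innerSL ℝ p₁) x) (h₂ : HasFDerivAt f₂ (innerSL ℝ p₂) x)
    (heq : f₁ x = f₂ x) :
    (2⁻¹ : ℝ) • (p₁ + p₂) ∈ subdiff Ω (fun z => max (f₁ z) (f₂ z)) x := by
  intro ε hε
  apply Filter.Eventually.filter_mono nhdsWithin_le_nhds
  filter_upwards [h₁.isLittleO.bound hε, h₂.isLittleO.bound hε] with z hz₁ hz₂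
  rw [Real.norm_eq_abs, abs_le, innerSL_apply_apply] at hz₁ hz₂
  rw [inner_smul_left, inner_add_left, heq, max_self]
  simp only [conj_trivial]
  have := le_max_left (f₁ z) (f₂ z)
  have := le_max_right (f₁ z) (f₂ z)
  linarith [hz₁.1, hz₂.1]

/-- The maximum principle for two mountains: if the `c`-subdifferential and the subdifferential
of `c`-convex functions agree, then a mountain whose slope at `x` is the midpoint of two other
slopes lies below the maximum of the corresponding mountains. -/
lemma neg_add_le_max_of_cSubdiff_eq_subdiff (hΩ : IsOpen Ω) (hΛ : IsOpen Λ) (h0 : A0 c Ω Λ)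
    (h1 : A1 c Ω Λ) (hsub : ∀ φ : E → ℝ, IsCConvexOn c Ω Λ φ → ∀ x ∈ Ω,
      cSubdiff c Ω Λ φ x = subdiff Ω φ x)
    {y₁ y₂ : E} (hx : x ∈ Ω) (hy : y ∈ Λ) (hy₁ : y₁ ∈ Λ) (hy₂ : y₂ ∈ Λ)
    (hmid : (2⁻¹ : ℝ) • (negGradX c x y₁ + negGradX c x y₂) = negGradX c x y)
    {z : E} (hz : z ∈ Ω) :
    -c z y + c x y ≤ max (-c z y₁ + c x y₁) (-c z y₂ + c x y₂) := by
  have hderiv : ∀ y' ∈ Λ, HasFDerivAt (fun z => -c z y' + c x y')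
      (innerSL ℝ (negGradX c x y')) x := by
    intro y' hy'
    have hd := ((contDiffAt_cost_fst (h0.contDiffAt hΩ hΛ hx hy')).differentiableAt
      (by norm_num)).hasFDerivAt
    refine (hd.neg.add_const (c x y')).congr_fderiv ?_
    ext v
    simp [inner_negGradX]
  have hp := midpoint_mem_subdiff_max (Ω := Ω) (hderiv y₁ hy₁) (hderiv y₂ hy₂) (by simp)
  rw [hmid, ← hsub _ (isCConvexOn_max hy₁ hy₂) x hx] at hp
  obtain ⟨y', ⟨hy', hcontact⟩, heq⟩ := hp
  obtain rfl : y' = y := h1.1 x hx hy' (subset_closure hy) heq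
  have hle : ((-c z y' - max (-c z y₁ + c x y₁) (-c z y₂ + c x y₂) : ℝ) : EReal) ≤
      cStarTransform c Ω (fun z => max (-c z y₁ + c x y₁) (-c z y₂ + c x y₂)) y' :=
    le_iSup₂_of_le z hz le_rfl
  simp only [neg_add_cancel, max_self, EReal.coe_zero, zero_add] at hcontact
  rw [hcontact, EReal.coe_le_coe_iff] at hle
  linarith

end Cost

theorem statement1 (c : E → E → ℝ) (Ω Λ : Set E) (hΩ : IsOpen Ω) (hΛ : IsOpen Λ)
    (h0 : A0 c Ω Λ) (h1 : A1 c Ω Λ) (h2 : A2 c Ω Λ)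
    (hΛconv : CConvexTarget c Ω Λ) (hΩconv : CStarConvexSource c Ω Λ)
    (hCSIS : ∀ φ : E → ℝ, IsCConvexOn c Ω Λ φ → ∀ x ∈ Ω,
      cSubdiff c Ω Λ φ x = subdiff Ω φ x) :
    A3W c Ω Λ := by
  intro x hx y hy η ξ hηξ
  by_contra! hneg
  have hξ : ξ ≠ 0 := by
    rintro rfl
    simp [cSectional] at hneg
  set p := negGradX c x y
  obtain ⟨hdom, hexp⟩ := cExpDom_mem_nhds_and_contDiffAt_cExp hΩ hΛ h0 h1 h2 hx hy
  set Y : ℝ → E := fun t => cExp c Λ x (p + t • ξ) with hY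
  have hY0 : Y 0 = y := by simp [hY, p, cExp_negGradX h1 hx hy]
  set B : ℝ → E →L[ℝ] E →L[ℝ] ℝ := fun t => fderiv ℝ (fderiv ℝ (fun x' => c x' (Y t))) x
  set H : ℝ → ℝ := fun t => -B t η η with hH
  have hHneg : deriv (deriv H) 0 < 0 := by
    simp only [cSectional, iteratedFDeriv_two_apply] at hneg
    exact hneg
  have hline : ContDiff ℝ 2 (fun t : ℝ => p + t • ξ) := by fun_prop
  have hYsmooth : ContDiffAt ℝ 2 Y 0 := by
    refine ContDiffAt.comp (0 : ℝ) (g := cExp c Λ x) ?_ hline.contDiffAt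
    simpa using hexp.of_le (by norm_num)
  have hHsmooth : ContDiffAt ℝ 2 H 0 := by
    have hB : ContDiffAt ℝ 2 B 0 := by
      refine ContDiffAt.comp (0 : ℝ)
        (g := fun y' => fderiv ℝ (fderiv ℝ (fun x' => c x' y')) x) ?_ hYsmooth
      rw [hY0]
      exact contDiffAt_fderiv_fderiv_fst (h0.contDiffAt hΩ hΛ hx hy)
    exact ((hB.clm_apply contDiffAt_const).clm_apply contDiffAt_const).neg
  have hHbelow : ∀ᶠ t in 𝓝[≠] (0 : ℝ), H t - deriv H 0 * t < H 0 := by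
    have h := eventually_lt_of_hasDerivAt_neg (f := fun t => H t - deriv H 0 * t)
      (f' := fun t => deriv H t - deriv H 0) (x₀ := 0) ?_ (sub_self _) ?_ hHneg
    · simpa using h
    · filter_upwards [hHsmooth.eventually (by simp)] with t ht
      exact ((ht.differentiableAt (by norm_num)).hasDerivAt.sub
        ((hasDerivAt_id t).const_mul (deriv H 0))).congr_deriv (by simp)
    · have h' : ContDiffAt ℝ 1 (fun t => fderiv ℝ H t 1) 0 :=
        (hHsmooth.fderiv_right (by norm_num)).clm_apply contDiffAt_const
      simp only [fderiv_apply_one_eq_deriv] at h'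
      exact (h'.differentiableAt (by norm_num)).hasDerivAt.sub_const _
  have hdomt : ∀ᶠ t in 𝓝 (0 : ℝ), p + t • ξ ∈ cExpDom c Λ x :=
    hline.continuous.continuousAt.eventually (by simpa using hdom)
  have hflip : Tendsto (fun t : ℝ => -t) (𝓝[≠] 0) (𝓝[≠] 0) := by
    refine tendsto_nhdsWithin_iff.mpr ⟨?_, ?_⟩
    · simpa using (tendsto_neg (0 : ℝ)).mono_left nhdsWithin_le_nhds
    · filter_upwards [self_mem_nhdsWithin] with t ht
      simpa using ht
  obtain ⟨t, ⟨⟨hHt, hdt⟩, hHt', hdt'⟩⟩ :=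
    ((hHbelow.and (hdomt.filter_mono nhdsWithin_le_nhds)).and
      (hflip.eventually (hHbelow.and (hdomt.filter_mono nhdsWithin_le_nhds)))).exists
  set w : E := (-(deriv H 0) / (2 * ‖ξ‖ ^ 2)) • ξ with hw
  have hξw : 2 * ⟪ξ, w⟫ = -deriv H 0 := by
    have : ‖ξ‖ ≠ 0 := norm_ne_zero_iff.mpr hξ
    rw [hw, inner_smul_right, real_inner_self_eq_norm_sq]
    field_simp
  have hbelow : ∀ s : ℝ, H s - deriv H 0 * s < H 0 → p + s • ξ ∈ cExpDom c Λ x →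
      ∀ᶠ ε in 𝓝[≠] (0 : ℝ), -c (x + ε • η + ε ^ 2 • w) (Y s) + c x (Y s) <
        -c (x + ε • η + ε ^ 2 • w) y + c x y := by
    intro s hHs hds
    have hs := contDiffAt_cost_fst (h0.contDiffAt hΩ hΛ hx (cExp_mem hds))
    have hy' := contDiffAt_cost_fst (h0.contDiffAt hΩ hΛ hx hy)
    have hDs : ∀ v, fderiv ℝ (fun x' => c x' (Y s)) x v
        = fderiv ℝ (fun x' => c x' y) x v - s * ⟪ξ, v⟫ := by
      intro v
      have h := inner_negGradX (c := c) x (Y s) v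
      rw [negGradX_cExp hds, inner_add_left, inner_smul_left, inner_negGradX] at h
      simp only [conj_trivial] at h
      linarith
    have key := eventually_lt_along_parabola (x := x) (η := η) (w := w)
      (f := fun z => c z y - c z (Y s))
      (f' := fun z => fderiv ℝ (fun x' => c x' y) z - fderiv ℝ (fun x' => c x' (Y s)) z)
      (f'' := B 0 - B s) ?_ ?_ ?_ ?_
    · filter_upwards [key] with ε hε
      linarith
    · filter_upwards [hs.eventually (by simp), hy'.eventually (by simp)] with z hzs hzy
      exact (hzy.differentiableAt (by norm_num)).hasFDerivAt.sub
        (hzs.differentiableAt (by norm_num)).hasFDerivAt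
    · have hdiff : ∀ {g : E → ℝ}, ContDiffAt ℝ 4 g x →
          HasFDerivAt (fderiv ℝ g) (fderiv ℝ (fderiv ℝ g) x) x := fun hg =>
        ((hg.fderiv_right (m := 1) (by norm_num)).differentiableAt (by norm_num)).hasFDerivAt
      have h := (hdiff hy').sub (hdiff hs)
      simp only [B, hY0]
      exact h
    · simp [hDs, real_inner_comm, hηξ]
    · have : (B 0 - B s) η η = H s - H 0 := by simp [hH]; ring
      rw [this]
      simp only [sub_apply, hDs]
      linear_combination hHs + s * hξw
  have hΩε : ∀ᶠ ε in 𝓝 (0 : ℝ), x + ε • η + ε ^ 2 • w ∈ Ω := by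
    have hc : Continuous fun ε : ℝ => x + ε • η + ε ^ 2 • w := by fun_prop
    exact hc.continuousAt.eventually (hΩ.mem_nhds (by simpa using hx))
  obtain ⟨ε, ⟨h₁, h₂⟩, hε⟩ := (((hbelow t hHt hdt).and (hbelow (-t) hHt' hdt')).and
    (hΩε.filter_mono nhdsWithin_le_nhds)).exists
  refine absurd (neg_add_le_max_of_cSubdiff_eq_subdiff hΩ hΛ h0 h1 hCSIS hx hy (cExp_mem hdt)
    (cExp_mem hdt') ?_ hε) (not_le.mpr (max_lt h₁ h₂))
  rw [negGradX_cExp hdt, negGradX_cExp hdt']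
  module

end
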